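/- arXiv:1208.3362 — 2 statements merged into one kernel-verified Lean document; each statement's English description precedes it below -/
import Mathlib

section
/- Let C be a left-cancellative category and S a subfamily of its morphisms. Then any two S-normal decompositions of the same morphism of C are deformations by invertible elements (C×-deformations) of one another. -/
open CategoryTheory

universe u v

namespace GarsideTest

variable {C : Type u} [Category.{v} C]

/-- `C` is left-cancellative. -/
def LeftCancellative (C : Type u) [Category.{v} C] : Prop :=
  ∀ ⦃x y z : C⦄ (f : x ⟶ y) (g g' : y ⟶ z), f ≫ g = f ≫ g' → g = g'

/-- `f` left-divides `g`. -/
def LDiv {x y z : C} (f : x ⟶ y) (g : x ⟶ z) : Prop :=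
  ∃ r : y ⟶ z, f ≫ r = g

/-- `f` properly left-divides `g` (`f ⊏ g`). -/
def LDivStrict {x y z : C} (f : x ⟶ y) (g : x ⟶ z) : Prop :=
  LDiv f g ∧ ¬ LDiv g f

/-- `f =× g` : `g` is obtained from `f` by right-multiplication by an invertible element. -/
def EqIr {x y z : C} (f : x ⟶ y) (g : x ⟶ z) : Prop :=
  ∃ e : y ⟶ z, IsIso e ∧ f ≫ e = g

/-- The family `S♯ = S C× ∪ C×`. -/
def Sharp (S : MorphismProperty C) : MorphismProperty C :=
  fun x z g =>
    (∃ (y : C) (s : x ⟶ y) (e : y ⟶ z), S s ∧ IsIso e ∧ s ≫ e = g) ∨ IsIso g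

/-- Composable paths of morphisms of `C`. -/
inductive Path {C : Type u} [Category.{v} C] : C → C → Type (max u v)
  | nil (x : C) : Path x x
  | cons {x y z : C} (g : x ⟶ y) (p : Path y z) : Path x z

namespace Path

/-- The composite of a path. -/
def comp : ∀ {x z : C}, Path x z → (x ⟶ z)
  | _, _, nil x => 𝟙 x
  | _, _, cons g p => g ≫ p.comp

/-- The length of a path. -/
def length : ∀ {x z : C}, Path x z → ℕ
  | _, _, nil _ => 0
  | _, _, cons _ p => p.length + 1

/-- All entries of the path lie in `T`. -/
def Entries (T : MorphismProperty C) : ∀ {x z : C}, Path x z → Prop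
  | _, _, nil _ => True
  | _, _, cons g p => T g ∧ Entries T p

/-- Concatenation of paths. -/
def append : ∀ {x y z : C}, Path x y → Path y z → Path x z
  | _, _, _, nil _, q => q
  | _, _, _, cons g p, q => cons g (p.append q)

open scoped Classical in
/-- Number of non-invertible entries of a path. -/
noncomputable def ninv : ∀ {x z : C}, Path x z → ℕ
  | _, _, nil _ => 0
  | _, _, cons g p => (if IsIso g then 0 else 1) + p.ninv

end Path

/-- The length-two path `(g₁, g₂)` is `S`-greedy. -/
def Greedy2 (S : MorphismProperty C) {x y z : C} (g₁ : x ⟶ y) (g₂ : y ⟶ z) : Prop :=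
  ∀ ⦃u w : C⦄ (f : u ⟶ x) (h : u ⟶ w), S h → LDiv h (f ≫ g₁ ≫ g₂) → LDiv h (f ≫ g₁)

/-- Auxiliary: the path `g :: p` is `S`-greedy. -/
def Path.GreedyFrom (S : MorphismProperty C) : ∀ {x y z : C}, (x ⟶ y) → Path y z → Prop
  | _, _, _, _, .nil _ => True
  | _, _, _, g, .cons g' p => Greedy2 S g g' ∧ Path.GreedyFrom S g' p

/-- The path `p` is `S`-greedy. -/
def Path.Greedy (S : MorphismProperty C) : ∀ {x z : C}, Path x z → Prop
  | _, _, .nil _ => True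
  | _, _, .cons g p => Path.GreedyFrom S g p

/-- The path `p` is `S`-normal: `S`-greedy with entries in `S♯`. -/
def Path.Normal (S : MorphismProperty C) {x z : C} (p : Path x z) : Prop :=
  p.Greedy S ∧ p.Entries (Sharp S)

/-- `p` is an `S`-normal decomposition of the morphism `g`. -/
def IsNormalDecomp (S : MorphismProperty C) {x z : C} (g : x ⟶ z) (p : Path x z) : Prop :=
  p.Normal S ∧ p.comp = g

/-- `X` generates `C`. -/
def Generates (X : MorphismProperty C) : Prop :=
  ∀ ⦃x z : C⦄ (g : x ⟶ z), ∃ p : Path x z, p.Entries X ∧ p.comp = g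

/-- `S` is a Garside family in `C`. -/
def IsGarside (S : MorphismProperty C) : Prop :=
  ∀ ⦃x z : C⦄ (g : x ⟶ z), ∃ p : Path x z, IsNormalDecomp S g p

/-- `Xʳ`: morphisms expressible as composites of `r` elements of `X`. -/
def MPow (X : MorphismProperty C) (r : ℕ) : MorphismProperty C :=
  fun x z g => ∃ p : Path x z, p.Entries X ∧ p.length = r ∧ p.comp = g

/-- `X` is closed under right-complement. -/
def ClosedUnderRightComplement (X : MorphismProperty C) : Prop :=
  ∀ ⦃x y y' z : C⦄ (f : x ⟶ y) (g : x ⟶ y') (h : x ⟶ z), X f → X g →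
    LDiv f h → LDiv g h →
    ∃ (w : C) (g' : y ⟶ w) (f' : y' ⟶ w),
      X g' ∧ X f' ∧ f ≫ g' = g ≫ f' ∧ LDiv (f ≫ g') h

/-- `X` is closed under right-comultiple. -/
def ClosedUnderRightComultiple (X : MorphismProperty C) : Prop :=
  ∀ ⦃x y y' z : C⦄ (f : x ⟶ y) (g : x ⟶ y') (h : x ⟶ z), X f → X g →
    LDiv f h → LDiv g h →
    ∃ (w : C) (h' : x ⟶ w), X h' ∧ LDiv f h' ∧ LDiv g h' ∧ LDiv h' h

/-- `X` is closed under right-divisor. -/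
def ClosedUnderRightDivisor (X : MorphismProperty C) : Prop :=
  ∀ ⦃x y z : C⦄ (f : x ⟶ y) (g : y ⟶ z), X (f ≫ g) → X g

/-- `g₁` is an `S`-head of `g`. -/
def IsHead (S : MorphismProperty C) {x w y : C} (g₁ : x ⟶ w) (g : x ⟶ y) : Prop :=
  S g₁ ∧ LDiv g₁ g ∧ ∀ ⦃w' : C⦄ (h : x ⟶ w'), S h → LDiv h g → LDiv h g₁

/-- `h` is a right-lcm of `f` and `g`. -/
def IsRightLcm {x y y' w : C} (f : x ⟶ y) (g : x ⟶ y') (h : x ⟶ w) : Prop :=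
  LDiv f h ∧ LDiv g h ∧ ∀ ⦃w' : C⦄ (h' : x ⟶ w'), LDiv f h' → LDiv g h' → LDiv h h'

/-- `X` is closed under right-lcm. -/
def ClosedUnderRightLcm (X : MorphismProperty C) : Prop :=
  ∀ ⦃x y y' w : C⦄ (f : x ⟶ y) (g : x ⟶ y') (h : x ⟶ w), X f → X g →
    IsRightLcm f g h → X h

/-- `C` is right-Noetherian: proper right-divisibility is well-founded. -/
def RightNoetherian (C : Type u) [Category.{v} C] : Prop :=
  WellFounded (fun a b : Σ (x : C) (y : C), x ⟶ y =>
    ∃ (e : a.2.1 = b.2.1) (g' : b.1 ⟶ a.1), ¬ IsIso g' ∧ g' ≫ a.2.2 ≫ eqToHom e = b.2.2)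

/-- `C` is left-Noetherian: proper left-divisibility is well-founded. -/
def LeftNoetherian (C : Type u) [Category.{v} C] : Prop :=
  WellFounded (fun a b : Σ (x : C) (y : C), x ⟶ y =>
    ∃ (e : b.1 = a.1) (g' : a.2.1 ⟶ b.2.1), ¬ IsIso g' ∧ eqToHom e ≫ a.2.2 ≫ g' = b.2.2)

/-- `g` is an atom of `C`. -/
def IsAtomMor {x y : C} (g : x ⟶ y) : Prop :=
  ¬ IsIso g ∧ ∀ ⦃w : C⦄ (f : x ⟶ w) (h : w ⟶ y), f ≫ h = g → IsIso f ∨ IsIso h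

/-- The only invertible morphisms of `C` are identities. -/
def NoNontrivialInvertible (C : Type u) [Category.{v} C] : Prop :=
  ∀ ⦃x y : C⦄ (e : x ⟶ y), IsIso e → ∃ h : x = y, e = eqToHom h

/-- Deformation by invertible elements, with a connecting morphism `e` at the left end. -/
inductive DeformRel : ∀ {xf xg z : C}, (xf ⟶ xg) → Path xf z → Path xg z → Prop
  | nil (z : C) : DeformRel (𝟙 z) (.nil z) (.nil z)
  | cons {xf xg yf yg z : C} (e : xf ⟶ xg) (f : xf ⟶ yf) (g : xg ⟶ yg) (e' : yf ⟶ yg)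
      {p : Path yf z} {q : Path yg z} :
      IsIso e' → e ≫ g = f ≫ e' → DeformRel e' p q →
      DeformRel e (.cons f p) (.cons g q)
  | padF {xg yg z : C} (e : z ⟶ xg) (g : xg ⟶ yg) (e' : z ⟶ yg) {q : Path yg z} :
      IsIso e' → e ≫ g = e' → DeformRel e' (.nil z) q →
      DeformRel e (.nil z) (.cons g q)
  | padG {xf yf z : C} (e : xf ⟶ z) (f : xf ⟶ yf) (e' : yf ⟶ z) {p : Path yf z} :
      IsIso e' → e = f ≫ e' → DeformRel e' p (.nil z) →
      DeformRel e (.cons f p) (.nil z)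

/-- `p` is a `C×`-deformation of `q`. -/
def IsDeformation {x z : C} (p q : Path x z) : Prop :=
  DeformRel (𝟙 x) p q

theorem LeftCancellative.isIso_of_comp_eq_id (hC : LeftCancellative C) {x y : C} {f : x ⟶ y}
    {r : y ⟶ x} (h : f ≫ r = 𝟙 x) : IsIso f :=
  ⟨r, h, hC f _ _ (by rw [← Category.assoc, h, Category.id_comp, Category.comp_id])⟩

/-- An `S`-greedy pair is also `S♯`-greedy. -/
theorem Greedy2.sharp {S : MorphismProperty C} {x y z : C} {g₁ : x ⟶ y} {g₂ : y ⟶ z}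
    (hg : Greedy2 S g₁ g₂) : Greedy2 (Sharp S) g₁ g₂ := by
  rintro u w f h (⟨v, s, e, hs, he, rfl⟩ | hh) hd
  · obtain ⟨r, hr⟩ := hd
    obtain ⟨t, ht⟩ := hg f s hs ⟨e ≫ r, by rw [← hr, Category.assoc]⟩
    exact ⟨inv e ≫ t, by simp [ht]⟩
  · exact ⟨inv h ≫ f ≫ g₁, by simp⟩

/-- In a greedy path, any element of `S♯` dividing a left multiple of the composite already
divides the corresponding multiple of the first entry. -/
theorem Path.GreedyFrom.ldiv {S : MorphismProperty C} {y z : C} {p : Path y z} :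
    ∀ {x : C} {g : x ⟶ y}, Path.GreedyFrom S g p →
      ∀ {u w : C} (f : u ⟶ x) (h : u ⟶ w), Sharp S h →
        LDiv h (f ≫ g ≫ p.comp) → LDiv h (f ≫ g) := by
  induction p with
  | nil z =>
    intro x g _ u w f h _ hd
    simpa [Path.comp] using hd
  | cons g' p ih =>
    intro x g hg u w f h hh hd
    refine hg.1.sharp f h hh ?_
    rw [← Category.assoc]
    exact ih hg.2 (f ≫ g) h hh (by simpa [Path.comp] using hd)

theorem Path.GreedyFrom.greedy {S : MorphismProperty C} {x y z : C} {g : x ⟶ y} {p : Path y z}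
    (h : Path.GreedyFrom S g p) : p.Greedy S := by
  cases p with
  | nil => trivial
  | cons g' p => exact h.2

theorem DeformRel.of_nil_left (hC : LeftCancellative C) {x z : C} {q : Path x z} :
    ∀ {e : z ⟶ x}, IsIso e → e ≫ q.comp = 𝟙 z → DeformRel e (.nil z) q := by
  induction q with
  | nil z =>
    intro e _ h
    obtain rfl : e = 𝟙 z := by simpa [Path.comp] using h
    exact .nil z
  | @cons x y z g q ih =>
    intro e _ h
    simp only [Path.comp, ← Category.assoc] at h
    have he' : IsIso (e ≫ g) := hC.isIso_of_comp_eq_id h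
    exact .padF e g (e ≫ g) he' rfl (ih he' h)

theorem DeformRel.of_nil_right (hC : LeftCancellative C) {x z : C} {p : Path x z} :
    ∀ {e : x ⟶ z}, IsIso e → e = p.comp → DeformRel e p (.nil z) := by
  induction p with
  | nil z =>
    rintro e _ rfl
    exact .nil z
  | @cons x y z f p ih =>
    rintro e he rfl
    change IsIso (f ≫ p.comp) at he
    have hf : IsIso f := hC.isIso_of_comp_eq_id (r := p.comp ≫ inv (f ≫ p.comp)) (by
      rw [← Category.assoc, IsIso.hom_inv_id])
    have hp : IsIso p.comp := @IsIso.of_isIso_comp_left _ _ _ _ _ f p.comp hf he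
    exact .padG _ f p.comp hp rfl (ih hp rfl)

/-- Two normal paths whose composites agree up to an invertible morphism on the left are
deformations of one another, with that morphism as left connecting morphism. -/
theorem DeformRel.of_normal (hC : LeftCancellative C) {S : MorphismProperty C} {x z : C}
    {p : Path x z} :
    ∀ {y : C} {q : Path y z} {e : x ⟶ y}, p.Normal S → q.Normal S → IsIso e →
      e ≫ q.comp = p.comp → DeformRel e p q := by
  induction p with
  | nil z =>
    intro y q e _ _ he h
    exact .of_nil_left hC he h
  | @cons x x' z f p ih =>
    intro y q e hp hq he h
    cases q with
    | nil => exact .of_nil_right hC he (by simpa [Path.comp] using h)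
    | @cons _ y' _ g q =>
      obtain ⟨hpg, hf, hpe⟩ := hp
      obtain ⟨hqg, hg, hqe⟩ := hq
      simp only [Path.comp] at h
      obtain ⟨a, ha⟩ : LDiv f (e ≫ g) :=
        Path.GreedyFrom.ldiv hqg e f hf ⟨p.comp, h.symm⟩
      obtain ⟨b, hb⟩ : LDiv g (inv e ≫ f) :=
        Path.GreedyFrom.ldiv hpg (inv e) g hg ⟨q.comp, by simp [← h]⟩
      have hb' : e ≫ g ≫ b = f := by simp [hb]
      have hab : a ≫ b = 𝟙 x' := hC f _ _ (by
        rw [← Category.assoc, ha, Category.assoc, hb', Category.comp_id])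
      have ha' : IsIso a := hC.isIso_of_comp_eq_id hab
      refine .cons e f g a ha' ha.symm
        (ih ⟨Path.GreedyFrom.greedy hpg, hpe⟩ ⟨Path.GreedyFrom.greedy hqg, hqe⟩ ha'
          (hC f _ _ ?_))
      rw [← Category.assoc, ha, Category.assoc, h]

theorem stmt5 {C : Type u} [Category.{v} C] (hC : LeftCancellative C)
    (S : MorphismProperty C) {x z : C} (g : x ⟶ z) (p q : Path x z)
    (hp : IsNormalDecomp S g p) (hq : IsNormalDecomp S g q) :
    IsDeformation p q ∧ IsDeformation q p := by
  have key {p q : Path x z} (hp : IsNormalDecomp S g p) (hq : IsNormalDecomp S g q) :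
      IsDeformation p q :=
    .of_normal hC hp.1 hq.1 inferInstance (by rw [Category.id_comp, hp.2, hq.2])
  exact ⟨key hp hq, key hq hp⟩

end GarsideTest
end

section
/- If S is a Garside family in a left-cancellative category C, then S♯ is closed under right-divisor, closed under right-comultiple, and closed under right-complement; moreover C×S♯ ⊆ S♯, i.e. any composite of an invertible morphism followed by an element of S♯ lies in S♯. -/
open CategoryTheory

universe u v

namespace GarsideTest

variable {C : Type u} [Category.{v} C]

theorem Greedy2.lDiv_of_sharp {S : MorphismProperty C} {x y z : C} {g₁ : x ⟶ y} {g₂ : y ⟶ z}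
    (hg : Greedy2 S g₁ g₂) {u w : C} (f : u ⟶ x) (h : u ⟶ w) (hh : Sharp S h)
    (hd : LDiv h (f ≫ g₁ ≫ g₂)) : LDiv h (f ≫ g₁) := by
  rcases hh with ⟨_, s, e, hs, he, rfl⟩ | hh
  · obtain ⟨r, hr⟩ := hd
    obtain ⟨t, ht⟩ := hg f s hs ⟨e ≫ r, by simpa using hr⟩
    exact ⟨inv e ≫ t, by simpa using ht⟩
  · exact ⟨inv h ≫ f ≫ g₁, by simp⟩

/-- An element of `S♯` dividing `f` followed by a greedy path divides `f` followed by the first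
entry of the path. -/
theorem Path.GreedyFrom.lDiv_of_sharp {S : MorphismProperty C} {y z : C} (p : Path y z) :
    ∀ {x : C} {g : x ⟶ y}, Path.GreedyFrom S g p → ∀ {u w : C} (f : u ⟶ x) (h : u ⟶ w),
      Sharp S h → LDiv h (f ≫ g ≫ p.comp) → LDiv h (f ≫ g) := by
  induction p with
  | nil _ =>
    intro x g _ u w f h _ hd
    simpa [Path.comp] using hd
  | cons g' p ih =>
    intro x g hg u w f h hh hd
    have hd' : LDiv h ((f ≫ g) ≫ g' ≫ p.comp) := by simpa [Path.comp] using hd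
    exact hg.1.lDiv_of_sharp f h hh (by simpa using ih hg.2 (f ≫ g) h hh hd')

/-- In the presence of a Garside family, every morphism has a greatest left-divisor in `S♯`,
uniformly under precomposition. -/
theorem IsGarside.exists_sharp_head {S : MorphismProperty C} (hS : IsGarside S) {x z : C}
    (g : x ⟶ z) : ∃ (y : C) (g₁ : x ⟶ y), Sharp S g₁ ∧ LDiv g₁ g ∧
      ∀ ⦃u w : C⦄ (f : u ⟶ x) (h : u ⟶ w), Sharp S h → LDiv h (f ≫ g) → LDiv h (f ≫ g₁) := by
  obtain ⟨p, ⟨hp, hs⟩, rfl⟩ := hS g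
  cases p with
  | nil _ =>
    exact ⟨x, 𝟙 x, Or.inr inferInstance, ⟨𝟙 x, by simp [Path.comp]⟩, fun _ _ _ _ _ hd => hd⟩
  | cons g₁ p =>
    exact ⟨_, g₁, hs.1, ⟨p.comp, rfl⟩, fun _ _ f h hh hd =>
      Path.GreedyFrom.lDiv_of_sharp p hp f h hh hd⟩

theorem Sharp.comp_isIso {S : MorphismProperty C} {x y z : C} {g : x ⟶ y} (hg : Sharp S g)
    (e : y ⟶ z) [IsIso e] : Sharp S (g ≫ e) := by
  rcases hg with ⟨_, s, e', hs, he, rfl⟩ | hg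
  · exact Or.inl ⟨_, s, e' ≫ e, hs, inferInstance, by simp⟩
  · exact Or.inr inferInstance

theorem IsGarside.closedUnderRightDivisor_sharp (hC : LeftCancellative C)
    {S : MorphismProperty C} (hS : IsGarside S) : ClosedUnderRightDivisor (Sharp S) := by
  intro x y z f g hfg
  obtain ⟨w, g₁, hg₁, ⟨r, hr⟩, hmax⟩ := hS.exists_sharp_head g
  obtain ⟨t, ht⟩ := hmax f (f ≫ g) hfg ⟨𝟙 _, by simp⟩
  have ht' : g ≫ t = g₁ := hC f _ _ (by simpa using ht)
  have : IsIso r := ⟨t, hC g₁ _ _ (by rw [← Category.assoc, hr, ht', Category.comp_id]),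
    hC g _ _ (by rw [← Category.assoc, ht', hr, Category.comp_id])⟩
  exact hr ▸ hg₁.comp_isIso r

theorem IsGarside.closedUnderRightComultiple_sharp {S : MorphismProperty C} (hS : IsGarside S) :
    ClosedUnderRightComultiple (Sharp S) := by
  intro x y y' z f g h hf hg hfh hgh
  obtain ⟨w, h₁, hh₁, hd, hmax⟩ := hS.exists_sharp_head h
  exact ⟨w, h₁, hh₁, by simpa using hmax (𝟙 x) f hf (by simpa using hfh),
    by simpa using hmax (𝟙 x) g hg (by simpa using hgh), hd⟩

theorem ClosedUnderRightComultiple.closedUnderRightComplement {X : MorphismProperty C}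
    (hm : ClosedUnderRightComultiple X) (hd : ClosedUnderRightDivisor X) :
    ClosedUnderRightComplement X := by
  intro x y y' z f g h hf hg hfh hgh
  obtain ⟨w, h', hh', ⟨g', hg'⟩, ⟨f', hf'⟩, hdiv⟩ := hm f g h hf hg hfh hgh
  exact ⟨w, g', f', hd f g' (hg' ▸ hh'), hd g f' (hf' ▸ hh'), hg'.trans hf'.symm, hg' ▸ hdiv⟩

theorem stmt11 {C : Type u} [Category.{v} C] (hC : LeftCancellative C)
    (S : MorphismProperty C) (hS : IsGarside S) :
    ClosedUnderRightDivisor (Sharp S) ∧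
    ClosedUnderRightComultiple (Sharp S) ∧
    ClosedUnderRightComplement (Sharp S) ∧
    (∀ ⦃x y z : C⦄ (e : x ⟶ y) (g : y ⟶ z), IsIso e → Sharp S g → Sharp S (e ≫ g)) := by
  have hd := hS.closedUnderRightDivisor_sharp hC
  have hm := hS.closedUnderRightComultiple_sharp
  refine ⟨hd, hm, hm.closedUnderRightComplement hd, fun x y z e g he hg => ?_⟩
  exact hd (inv e) (e ≫ g) (by simpa using hg)

end GarsideTest
end
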